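/- For every t > 0 there exist constants 0 < C₁ ≤ C₂ (depending only on t) such that for all ξ ∈ ℝ^d: C₁/(1+|ξ|²) ≤ ∫_0^t K(s,ξ) ds ≤ C₂/(1+|ξ|²), where K(s,ξ) = (sin(s|ξ|)/|ξ|)² for ξ ≠ 0 and K(s,0) = s². -/

import Mathlib

open MeasureTheory
open scoped Classical

/-- `K(s,ξ)` is the squared modulus of the Fourier transform `sin(s|ξ|)/|ξ|`
of the fundamental solution of the wave equation at time `s`. -/
noncomputable def waveKernelSq (d : ℕ) (s : ℝ) (ξ : EuclideanSpace ℝ (Fin d)) : ℝ :=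
  if ξ = 0 then s ^ 2 else (Real.sin (s * ‖ξ‖) / ‖ξ‖) ^ 2

/-- A cubic lower bound for `u - sin u` near the origin that is linear at infinity. -/
theorem cube_div_le_sub_sin {u : ℝ} (hu : 0 < u) :
    u ^ 3 / (20 * (1 + u ^ 2)) ≤ u - Real.sin u := by
  rw [div_le_iff₀ (by positivity)]
  have small : ∀ x : ℝ, 0 < x → x ≤ 1 → x ^ 3 / 10 ≤ x - Real.sin x := by
    intro x hx hx1
    have h := (abs_le.1 (Real.sin_bound (x := x) (by rwa [abs_of_pos hx]))).2
    rw [abs_of_pos hx] at h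
    have h5 : x ^ 5 ≤ x ^ 3 := pow_le_pow_of_le_one hx.le hx1 (by norm_num)
    have : 0 < x ^ 3 := by positivity
    linarith
  rcases le_total u 1 with h1 | h1
  · have h := small u hu h1
    have h3 : 0 < u ^ 3 := by positivity
    nlinarith [sq_nonneg u]
  · have key : u / 20 ≤ u - Real.sin u := by
      rcases le_total u 2 with h2 | h2
      · have h := small 1 one_pos le_rfl
        have hs : Real.sin u - Real.sin 1 ≤ u - 1 := by
          have hd := Real.abs_sin_sub_sin_le u 1
          rw [abs_of_nonneg (sub_nonneg.2 h1)] at hd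
          exact (le_abs_self _).trans hd
        linarith
      · linarith [Real.sin_le_one u]
    nlinarith [sq_nonneg u]

theorem integral_sin_mul_div_sq {r t : ℝ} (hr : 0 < r) (ht : 0 < t) :
    ∫ s in Set.Ioc (0:ℝ) t, (Real.sin (s * r) / r) ^ 2 =
      (2 * t * r - Real.sin (2 * t * r)) / (4 * r ^ 3) := by
  rw [← intervalIntegral.integral_of_le ht.le]
  simp_rw [div_pow]
  rw [intervalIntegral.integral_div,
    intervalIntegral.integral_comp_mul_right (fun x => Real.sin x ^ 2) hr.ne', integral_sin_sq,
    show 2 * t * r = 2 * (t * r) by ring, Real.sin_two_mul]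
  simp only [zero_mul, Real.sin_zero, smul_eq_mul]
  field_simp
  ring

theorem waveKernelSq_nonneg (d : ℕ) (s : ℝ) (ξ : EuclideanSpace ℝ (Fin d)) :
    0 ≤ waveKernelSq d s ξ := by
  unfold waveKernelSq
  split_ifs <;> positivity

theorem waveKernelSq_le (d : ℕ) (s : ℝ) (ξ : EuclideanSpace ℝ (Fin d)) :
    waveKernelSq d s ξ ≤ (1 + s ^ 2) / (1 + ‖ξ‖ ^ 2) := by
  unfold waveKernelSq
  split_ifs with h
  · simp [h]
  · have hr : 0 < ‖ξ‖ := norm_pos_iff.2 h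
    have h1 : Real.sin (s * ‖ξ‖) ^ 2 ≤ (s * ‖ξ‖) ^ 2 := sq_le_sq.2 Real.abs_sin_le_abs
    have h2 := Real.sin_sq_le_one (s * ‖ξ‖)
    rw [div_pow, div_le_div_iff₀ (by positivity) (by positivity)]
    nlinarith [sq_nonneg ‖ξ‖]

theorem integral_waveKernelSq_le (d : ℕ) {t : ℝ} (ht : 0 < t)
    (ξ : EuclideanSpace ℝ (Fin d)) :
    ∫ s in Set.Ioc (0:ℝ) t, waveKernelSq d s ξ ≤ t * (1 + t ^ 2) / (1 + ‖ξ‖ ^ 2) := by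
  have h := norm_setIntegral_le_of_norm_le_const (μ := volume) (s := Set.Ioc (0:ℝ) t)
    (f := fun s => waveKernelSq d s ξ) (C := (1 + t ^ 2) / (1 + ‖ξ‖ ^ 2)) (by simp) (by
      intro s hs
      rw [Real.norm_of_nonneg (waveKernelSq_nonneg d s ξ)]
      refine (waveKernelSq_le d s ξ).trans ?_
      have := hs.1.le
      have := hs.2
      gcongr)
  refine (Real.le_norm_self _).trans (h.trans_eq ?_)
  rw [Real.volume_real_Ioc_of_le ht.le]
  ring

theorem le_integral_waveKernelSq (d : ℕ) {t : ℝ} (ht : 0 < t)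
    (ξ : EuclideanSpace ℝ (Fin d)) :
    t ^ 3 / (10 * (1 + 4 * t ^ 2)) / (1 + ‖ξ‖ ^ 2) ≤
      ∫ s in Set.Ioc (0:ℝ) t, waveKernelSq d s ξ := by
  by_cases h : ξ = 0
  · simp only [waveKernelSq, h, if_true]
    rw [← intervalIntegral.integral_of_le ht.le, integral_pow]
    norm_num
    gcongr
    nlinarith [sq_nonneg t]
  · simp only [waveKernelSq, h, if_false]
    have hr : 0 < ‖ξ‖ := norm_pos_iff.2 h
    rw [integral_sin_mul_div_sq hr ht]
    generalize ‖ξ‖ = r at hr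
    calc t ^ 3 / (10 * (1 + 4 * t ^ 2)) / (1 + r ^ 2)
        = t ^ 3 / (10 * ((1 + 4 * t ^ 2) * (1 + r ^ 2))) := by rw [div_div, mul_assoc]
      _ ≤ t ^ 3 / (10 * (1 + (2 * t * r) ^ 2)) := by
          gcongr
          nlinarith [sq_nonneg t, sq_nonneg r]
      _ = (2 * t * r) ^ 3 / (20 * (1 + (2 * t * r) ^ 2)) / (4 * r ^ 3) := by
          field_simp
          ring
      _ ≤ _ := by
          gcongr
          exact cube_div_le_sub_sin (by positivity)

/-- For every `t > 0` there are constants `0 < C₁ ≤ C₂` such that for all `ξ ∈ ℝ^d`: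
`C₁/(1+|ξ|²) ≤ ∫_0^t K(s,ξ) ds ≤ C₂/(1+|ξ|²)`. -/
theorem stmt_5 (d : ℕ) (t : ℝ) (ht : 0 < t) :
    ∃ C₁ C₂ : ℝ, 0 < C₁ ∧ C₁ ≤ C₂ ∧
      ∀ ξ : EuclideanSpace ℝ (Fin d),
        C₁ / (1 + ‖ξ‖ ^ 2) ≤ (∫ s in Set.Ioc (0:ℝ) t, waveKernelSq d s ξ) ∧
        (∫ s in Set.Ioc (0:ℝ) t, waveKernelSq d s ξ) ≤ C₂ / (1 + ‖ξ‖ ^ 2) := by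
  have lower := le_integral_waveKernelSq d ht
  have upper := integral_waveKernelSq_le d ht
  refine ⟨_, _, by positivity, ?_, fun ξ => ⟨lower ξ, upper ξ⟩⟩
  simpa using (lower 0).trans (upper 0)
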